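/- Bias-learning universal approximation for feed-forward networks (main feed-forward theorem, instantiated at the ReLU activation): Let d, l ≥ 1 be natural numbers, let U ⊆ ℝ^d be compact, let h : ℝ^d → ℝ^l be continuous, and let ε > 0, δ ∈ (0,1), and R > 0. Then there exists a hidden-layer width m ∈ ℕ such that, if all entries of the weight matrices A ∈ ℝ^{l×m} and B ∈ ℝ^{m×d} are mutually independent random variables each uniformly distributedceon [−R, R], then with probability at least 1 − δ there exists a bias vector b ∈ ℝ^m with ∫_U ‖h(x) − A·ReLU(Bx + b)‖ dx ≤ ε, where the integral is with respect to Lebesgue measure on ℝ^d. -/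

import Mathlib

open MeasureTheory

/-- The ReLU activation function. -/
noncomputable def relu (t : ℝ) : ℝ := max t 0

/-- The uniform probability measure on the interval `[-R, R]`. -/
noncomputable def unif (R : ℝ) : Measure ℝ :=
  (volume (Set.Icc (-R) R))⁻¹ • volume.restrict (Set.Icc (-R) R)

/-- Index type for the weights of a width-`m` one-hidden-layer network with input
dimension `d` and output dimension `l`: output entries and input entries. -/
abbrev WeightIdx (m d l : ℕ) := (Fin l × Fin m) ⊕ (Fin m × Fin d)


lemma one_dim (f : ℝ → ℝ) (hf : Continuous f) (a b η : ℝ) (hab : a < b) (hη : 0 < η) :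
    ∃ g ∈ Submodule.span ℝ (Set.range (fun (c : ℝ) (t : ℝ) => relu (t + c)) ∪ {fun _ => (1:ℝ)}),
      ∀ t ∈ Set.Icc a b, |g t - f t| ≤ η := by
  have huc := (isCompact_Icc (a := a) (b := b)).uniformContinuousOn_of_continuous hf.continuousOn
  rw [Metric.uniformContinuousOn_iff] at huc
  obtain ⟨κ0, hκ0, huc⟩ := huc η hη
  obtain ⟨N, hN⟩ := exists_nat_gt ((b - a) / κ0)
  have hNpos : (0:ℝ) < N := lt_trans (div_pos (by linarith) hκ0) hN
  obtain ⟨κ, hκdef⟩ : ∃ κ, κ = (b - a) / N := ⟨_, rfl⟩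
  have hNκ : N * κ = b - a := by rw [hκdef]; field_simp
  have hκ : 0 < κ := by rw [hκdef]; exact div_pos (by linarith) hNpos
  have hκlt : κ < κ0 := by
    rw [hκdef, div_lt_iff₀ hNpos]
    rw [div_lt_iff₀ hκ0] at hN; linarith
  have key : ∀ n : ℕ, n ≤ N → ∃ g ∈ Submodule.span ℝ
      (Set.range (fun (c : ℝ) (t : ℝ) => relu (t + c)) ∪ {fun _ => (1:ℝ)}),
      (∀ t ∈ Set.Icc a (a + n * κ), |g t - f t| ≤ η) ∧
      (∀ t, a + n * κ ≤ t → g t = f (a + n * κ)) := by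
    intro n
    induction n with
    | zero =>
      intro _
      refine ⟨f a • (fun _ => (1:ℝ)), Submodule.smul_mem _ _ (Submodule.subset_span (by simp)), ?_, ?_⟩
      · intro t ht
        have : t = a := by
          have h1 := ht.1; have h2 := ht.2; simp at h2; linarith
        subst this; simp [hη.le]
      · intro t _; simp
    | succ n ih =>
      intro hn
      obtain ⟨g, hg, h1, h2⟩ := ih (by omega)
      obtain ⟨s, hs⟩ : ∃ s, s = a + n * κ := ⟨_, rfl⟩
      obtain ⟨s', hs'⟩ : ∃ s', s' = a + (n+1 : ℕ) * κ := ⟨_, rfl⟩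
      have hss : s' = s + κ := by rw [hs, hs']; push_cast; ring
      rw [← hs] at h1 h2
      rw [← hs']
      have has : a ≤ s := by rw [hs]; have := mul_nonneg (Nat.cast_nonneg (α := ℝ) n) hκ.le; linarith
      have hsb : s' ≤ b := by
        rw [hs']
        have : ((n+1 : ℕ):ℝ) ≤ N := by exact_mod_cast hn
        nlinarith
      refine ⟨g + ((f s' - f s) / κ) • ((fun t => relu (t + (-s))) - (fun t => relu (t + (-s')))),
        Submodule.add_mem _ hg (Submodule.smul_mem _ _ (Submodule.sub_mem _
          (Submodule.subset_span (Or.inl ⟨_, rfl⟩)) (Submodule.subset_span (Or.inl ⟨_, rfl⟩)))), ?_, ?_⟩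
      · intro t ht
        simp only [Pi.add_apply, Pi.smul_apply, Pi.sub_apply, smul_eq_mul, relu]
        rcases le_total t s with hts | hts
        · rw [max_eq_right (by linarith), max_eq_right (by linarith)]
          simpa using h1 t ⟨ht.1, hts⟩
        · rw [max_eq_left (by linarith), max_eq_right (by linarith [ht.2]), h2 t hts]
          have e1 := huc s ⟨has, by linarith⟩ t ⟨ht.1, by linarith [ht.2]⟩
            (by rw [Real.dist_eq, abs_lt]; constructor <;> linarith [ht.2])
          have e2 := huc s' ⟨by linarith, by linarith⟩ t ⟨ht.1, by linarith [ht.2]⟩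
            (by rw [Real.dist_eq, abs_lt]; constructor <;> linarith [ht.2])
          rw [Real.dist_eq, abs_lt] at e1 e2
          obtain ⟨r, hr⟩ : ∃ r, r = (t - s) / κ := ⟨_, rfl⟩
          have hr0 : 0 ≤ r := by rw [hr]; exact div_nonneg (by linarith) hκ.le
          have hr1 : r ≤ 1 := by rw [hr, div_le_one hκ]; linarith [ht.2]
          have : f s + (f s' - f s) / κ * (t + -s - 0) - f t =
              (1 - r) * (f s - f t) + r * (f s' - f t) := by rw [hr]; field_simp; ring
          rw [this, abs_le]
          constructor <;> nlinarith
      · intro t ht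
        simp only [Pi.add_apply, Pi.smul_apply, Pi.sub_apply, smul_eq_mul, relu]
        rw [max_eq_left (by linarith), max_eq_left (by linarith), h2 t (by linarith)]
        rw [hss]; field_simp; ring
  obtain ⟨g, hg, h1, -⟩ := key N le_rfl
  exact ⟨g, hg, by rw [hNκ] at h1; simpa using h1⟩

/-- span of ReLU ridge functions -/
noncomputable def ridgeSpan (d : ℕ) : Submodule ℝ ((Fin d → ℝ) → ℝ) :=
  Submodule.span ℝ (Set.range (fun (z : (Fin d → ℝ) × ℝ) (x : Fin d → ℝ) =>
    relu (∑ q, z.1 q * x q + z.2)))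

lemma approx_ridge (d : ℕ) (U : Set (Fin d → ℝ)) (hU : IsCompact U) (f : ℝ → ℝ)
    (hf : Continuous f) (w : Fin d → ℝ) (η : ℝ) (hη : 0 < η) :
    ∃ g ∈ ridgeSpan d, ∀ x ∈ U, |g x - f (∑ q, w q * x q)| ≤ η := by
  have hc : Continuous (fun x : Fin d → ℝ => ∑ q, w q * x q) := by fun_prop
  obtain ⟨M, hM⟩ := (hU.image hc).isBounded.exists_norm_le
  obtain ⟨g, hg, h1⟩ := one_dim f hf (-(|M| + 1)) (|M| + 1) η
    (by linarith [abs_nonneg M]) hη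
  refine ⟨LinearMap.funLeft ℝ ℝ (fun x : Fin d → ℝ => ∑ q, w q * x q) g, ?_, ?_⟩
  · rw [← Submodule.mem_comap]
    refine (Submodule.span_le.2 ?_) hg
    rintro _ (⟨c, rfl⟩ | rfl)
    · exact Submodule.subset_span ⟨(w, c), rfl⟩
    · exact Submodule.subset_span ⟨(0, 1), by ext x; simp [relu, LinearMap.funLeft]⟩
  · intro x hx
    have := hM _ ⟨x, hx, rfl⟩
    rw [Real.norm_eq_abs] at this
    have h3 := abs_le.1 (this.trans (le_abs_self M))
    exact h1 _ ⟨by linarith [h3.1], by linarith [h3.2]⟩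

lemma approx_scalar (d : ℕ) (U : Set (Fin d → ℝ)) (hU : IsCompact U)
    (f : (Fin d → ℝ) → ℝ) (hf : Continuous f) (η : ℝ) (hη : 0 < η) :
    ∃ g ∈ ridgeSpan d, ∀ x ∈ U, |g x - f x| ≤ η := by
  have : CompactSpace U := isCompact_iff_compactSpace.1 hU
  let e : Multiplicative (Fin d → ℝ) →* C(U, ℝ) :=
    { toFun := fun w => ⟨fun x => Real.exp (∑ q, w.toAdd q * x.1 q),
        Real.continuous_exp.comp (continuous_finsetSum _ fun q _ =>
          continuous_const.mul ((continuous_apply q).comp continuous_subtype_val))⟩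
      map_one' := by ext x; simp
      map_mul' := by
        intro v w; ext x
        simp [add_mul, Finset.sum_add_distrib, Real.exp_add] }
  have hsep : (Algebra.adjoin ℝ (MonoidHom.mrange e : Set C(U, ℝ))).SeparatesPoints := by
    intro x y hxy
    obtain ⟨q, hq⟩ : ∃ q, x.1 q ≠ y.1 q := by
      by_contra hcon
      push Not at hcon
      exact hxy (Subtype.ext (funext hcon))
    refine ⟨_, ⟨e (Multiplicative.ofAdd (Pi.single q 1)), Algebra.subset_adjoin ⟨_, rfl⟩, rfl⟩, ?_⟩
    simpa [e, Pi.single_apply] using hq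
  obtain ⟨⟨F, hF⟩, hFn⟩ :=
    ContinuousMap.exists_mem_subalgebra_near_continuousMap_of_separatesPoints _ hsep
      ⟨fun x : U => f x, by fun_prop⟩ (η / 2) (by linarith)
  have hP : ∀ F ∈ Submodule.span ℝ (MonoidHom.mrange e : Set C(U, ℝ)), ∀ η : ℝ, 0 < η →
      ∃ g ∈ ridgeSpan d, ∀ x : U, |g x - F x| ≤ η := by
    intro F hF
    induction hF using Submodule.span_induction with
    | mem F hF =>
      obtain ⟨w, rfl⟩ := hF
      intro η hη
      obtain ⟨g, hg, h1⟩ := approx_ridge d U hU Real.exp Real.continuous_exp w.toAdd η hη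
      exact ⟨g, hg, fun x => h1 x.1 x.2⟩
    | zero => intro η hη; exact ⟨0, Submodule.zero_mem _, fun x => by simpa using hη.le⟩
    | add F G _ _ hF hG =>
      intro η hη
      obtain ⟨f, hf, h1⟩ := hF (η / 2) (by linarith)
      obtain ⟨g, hg, h2⟩ := hG (η / 2) (by linarith)
      refine ⟨f + g, Submodule.add_mem _ hf hg, fun x => ?_⟩
      have a1 := abs_le.1 (h1 x)
      have a2 := abs_le.1 (h2 x)
      simp only [Pi.add_apply, ContinuousMap.add_apply]
      rw [abs_le]; constructor <;> linarith
    | smul r F _ hF =>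
      intro η hη
      have hr : 0 < |r| + 1 := by positivity
      obtain ⟨f, hf, h1⟩ := hF (η / (|r| + 1)) (by positivity)
      refine ⟨r • f, Submodule.smul_mem _ _ hf, fun x => ?_⟩
      simp only [Pi.smul_apply, ContinuousMap.smul_apply, smul_eq_mul]
      rw [← mul_sub, abs_mul]
      calc |r| * |f x - F x| ≤ (|r| + 1) * (η / (|r| + 1)) :=
            mul_le_mul (by linarith) (h1 x) (abs_nonneg _) hr.le
        _ = η := by field_simp
  have hF' : F ∈ Submodule.span ℝ (MonoidHom.mrange e : Set C(U, ℝ)) := by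
    have := (Algebra.adjoin_eq_span ℝ (MonoidHom.mrange e : Set C(U, ℝ)))
    rw [Submonoid.closure_eq] at this
    rw [← this]; exact hF
  obtain ⟨g, hg, h1⟩ := hP F hF' (η / 2) (by linarith)
  refine ⟨g, hg, fun x hx => ?_⟩
  have a1 := abs_le.1 (h1 ⟨x, hx⟩)
  have a2 := ((ContinuousMap.norm_coe_le_norm _ (⟨x, hx⟩ : U)).trans hFn.le)
  rw [Real.norm_eq_abs, abs_le] at a2
  simp only [ContinuousMap.sub_apply, ContinuousMap.coe_mk] at a1 a2
  rw [abs_le]; constructor <;> linarith [a1.1, a1.2, a2.1, a2.2]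

/-- single neurons with weights strictly inside the box -/
def neurons (d l : ℕ) (R : ℝ) : Set ((Fin d → ℝ) → Fin l → ℝ) :=
  {F | ∃ (a : Fin l → ℝ) (w : Fin d → ℝ) (c : ℝ), (∀ p, |a p| < R) ∧ (∀ q, |w q| < R) ∧
    F = fun x p => a p * relu (∑ q, w q * x q + c)}

lemma exists_nat_div_lt {ι : Type*} [Fintype ι] (v : ι → ℝ) (R : ℝ) (hR : 0 < R) :
    ∃ n : ℕ, 0 < n ∧ ∀ i, |v i / n| < R := by
  obtain ⟨n, hn⟩ := exists_nat_gt (‖v‖ / R)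
  refine ⟨n + 1, by omega, fun i => ?_⟩
  have h0 : (0:ℝ) < (n + 1 : ℕ) := by positivity
  rw [abs_div, abs_of_pos h0, div_lt_iff₀ h0]
  rw [div_lt_iff₀ hR] at hn
  have := norm_le_pi_norm v i
  rw [Real.norm_eq_abs] at this
  push_cast
  nlinarith

lemma relu_mul (k t : ℝ) (hk : 0 ≤ k) : relu (k * t) = k * relu t := by
  unfold relu; rw [mul_max_of_nonneg _ _ hk, mul_zero]

lemma single_mem (d l : ℕ) (R : ℝ) (hR : 0 < R) (p : Fin l) (g : (Fin d → ℝ) → ℝ)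
    (hg : g ∈ ridgeSpan d) :
    (fun x => Pi.single p (g x)) ∈ AddSubmonoid.closure (neurons d l R) := by
  unfold ridgeSpan at hg
  induction hg using Submodule.closure_induction with
  | zero =>
    convert AddSubmonoid.zero_mem _ using 1
    ext x; simp
  | add f g _ _ h1 h2 =>
    convert AddSubmonoid.add_mem _ h1 h2 using 1
    ext x; simp [Pi.single_add]
  | smul_mem r f hf =>
    obtain ⟨⟨w, c⟩, rfl⟩ := hf
    obtain ⟨k, hk, hw⟩ := exists_nat_div_lt w R hR
    obtain ⟨n, hn, ha⟩ := exists_nat_div_lt (Pi.single p (r * k) : Fin l → ℝ) R hR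
    have hk' : (0:ℝ) < k := by exact_mod_cast hk
    have hn' : (0:ℝ) < n := by exact_mod_cast hn
    have := AddSubmonoid.nsmul_mem (AddSubmonoid.closure (neurons d l R))
      (AddSubmonoid.subset_closure ⟨_, _, c / k, ha, hw, rfl⟩) n
    convert this using 1
    ext x p'
    have : ∑ q, w q * x q + c = k * (∑ q, w q / k * x q + c / k) := by
      rw [mul_add, Finset.mul_sum]
      congr 1
      · refine Finset.sum_congr rfl fun q _ => ?_
        field_simp
      · field_simp
    simp only [Pi.smul_apply, smul_eq_mul, nsmul_eq_mul]
    rw [this, relu_mul _ _ hk'.le]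
    by_cases hp : p' = p
    · subst hp; simp; field_simp
    · simp [hp]

lemma approx_vector (d l : ℕ) (U : Set (Fin d → ℝ)) (hU : IsCompact U)
    (h : (Fin d → ℝ) → Fin l → ℝ) (hh : Continuous h) (R : ℝ) (hR : 0 < R)
    (η : ℝ) (hη : 0 < η) :
    ∃ (N : ℕ) (a : Fin N → Fin l → ℝ) (w : Fin N → Fin d → ℝ) (c : Fin N → ℝ),
      (∀ j p, |a j p| < R) ∧ (∀ j q, |w j q| < R) ∧
      ∀ x ∈ U, ∀ p, |∑ j, a j p * relu (∑ q, w j q * x q + c j) - h x p| ≤ η := by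
  have h1 : ∀ p, ∃ g ∈ ridgeSpan d, ∀ x ∈ U, |g x - h x p| ≤ η := fun p =>
    approx_scalar d U hU (fun x => h x p) (by fun_prop) η hη
  choose g hg h1 using h1
  have hmem : (∑ p, fun x => Pi.single p (g p x)) ∈ AddSubmonoid.closure (neurons d l R) :=
    AddSubmonoid.sum_mem _ fun p _ => single_mem d l R hR p (g p) (hg p)
  obtain ⟨L, hL, hs⟩ := AddSubmonoid.exists_list_of_mem_closure hmem
  have h2 : ∀ j : Fin L.length, L[j] ∈ neurons d l R := fun j => hL _ (List.getElem_mem _)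
  choose a w c ha hw hF using h2
  refine ⟨L.length, a, w, c, ha, hw, fun x hx p => ?_⟩
  have : ∑ j, a j p * relu (∑ q, w j q * x q + c j) = g p x := by
    have e1 : ∑ j : Fin L.length, L[j] = L.sum := by simp
    rw [hs] at e1
    have e2 := congrFun (congrFun e1 x) p
    rw [Finset.sum_apply, Finset.sum_apply, Finset.sum_apply, Finset.sum_apply] at e2
    simp only [hF] at e2
    rw [e2]
    simp [Pi.single_apply]
  rw [this]
  exact h1 p x hx

lemma unif_prob (R : ℝ) (hR : 0 < R) : IsProbabilityMeasure (unif R) := by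
  constructor
  unfold unif
  rw [Measure.smul_apply, Measure.restrict_apply_univ, smul_eq_mul]
  refine ENNReal.inv_mul_cancel ?_ ?_
  · simp [hR]
  · simp

lemma unif_pos (R : ℝ) (a η : ℝ) (ha : |a| < R) (hη : 0 < η) :
    unif R (Metric.ball a η) ≠ 0 := by
  unfold unif
  rw [Measure.smul_apply, smul_eq_mul, Measure.restrict_apply Metric.isOpen_ball.measurableSet]
  refine mul_ne_zero (by simp) ?_
  have h1 : 0 < volume (Metric.ball a η ∩ Set.Ioo (-R) R) :=
    (Metric.isOpen_ball.inter isOpen_Ioo).measure_pos _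
      ⟨a, Metric.mem_ball_self hη, abs_lt.1 ha⟩
  exact (h1.trans_le (measure_mono (Set.inter_subset_inter_right _ Set.Ioo_subset_Icc_self))).ne'

lemma pi_unif_pos {ι : Type*} [Fintype ι] (R : ℝ) (hR : 0 < R) (θ : ι → ℝ) (hθ : ∀ i, |θ i| < R)
    (O : Set (ι → ℝ)) (hO : IsOpen O) (hmem : θ ∈ O) :
    Measure.pi (fun _ : ι => unif R) O ≠ 0 := by
  have := unif_prob R hR
  obtain ⟨η, hη, hb⟩ := Metric.isOpen_iff.1 hO θ hmem
  intro h0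
  have h1 := measure_mono_null hb h0
  rw [ball_pi _ hη, Measure.pi_pi] at h1
  exact Finset.prod_ne_zero_iff.2 (fun i _ => unif_pos R (θ i) η (hθ i) hη) h1

/-- regrouping of weights by neurons -/
def regroup {N K d l : ℕ} (z : Fin N × Fin K → (Fin l ⊕ Fin d) → ℝ) :
    WeightIdx (N * K) d l → ℝ :=
  Sum.elim (fun s => z (finProdFinEquiv.symm s.2) (Sum.inl s.1))
    (fun s => z (finProdFinEquiv.symm s.1) (Sum.inr s.2))

lemma regroup_measurable {N K d l : ℕ} : Measurable (@regroup N K d l) := by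
  refine measurable_pi_lambda _ fun s => ?_
  rcases s with s | s
  · exact (measurable_pi_apply (Sum.inl s.1)).comp
      (measurable_pi_apply (X := fun _ : Fin N × Fin K => (Fin l ⊕ Fin d) → ℝ)
        (finProdFinEquiv.symm s.2))
  · exact (measurable_pi_apply (Sum.inr s.2)).comp
      (measurable_pi_apply (X := fun _ : Fin N × Fin K => (Fin l ⊕ Fin d) → ℝ)
        (finProdFinEquiv.symm s.1))

lemma regroup_map (N K d l : ℕ) (R : ℝ) (hR : 0 < R) :
    Measure.pi (fun _ : WeightIdx (N * K) d l => unif R) =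
      (Measure.pi (fun _ : Fin N × Fin K => Measure.pi (fun _ : Fin l ⊕ Fin d => unif R))).map
        regroup := by
  have := unif_prob R hR
  refine Measure.pi_eq fun s hs => ?_
  rw [Measure.map_apply regroup_measurable (MeasurableSet.univ_pi hs)]
  have : (@regroup N K d l) ⁻¹' (Set.univ.pi s) = Set.univ.pi (fun jk => Set.univ.pi
      (Sum.elim (fun p => s (Sum.inl (p, finProdFinEquiv jk)))
        (fun q => s (Sum.inr (finProdFinEquiv jk, q))))) := by
    ext z
    simp only [Set.mem_preimage, Set.mem_univ_pi]
    constructor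
    · intro H jk t
      rcases t with p | q
      · simpa only [regroup, Sum.elim_inl, Sum.elim_inr, Equiv.symm_apply_apply,
          Equiv.apply_symm_apply] using H (Sum.inl (p, finProdFinEquiv jk))
      · simpa only [regroup, Sum.elim_inl, Sum.elim_inr, Equiv.symm_apply_apply,
          Equiv.apply_symm_apply] using H (Sum.inr (finProdFinEquiv jk, q))
    · intro H t
      rcases t with ⟨p, i⟩ | ⟨i, q⟩
      · simpa only [regroup, Sum.elim_inl, Sum.elim_inr, Equiv.symm_apply_apply,
          Equiv.apply_symm_apply] using H (finProdFinEquiv.symm i) (Sum.inl p)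
      · simpa only [regroup, Sum.elim_inl, Sum.elim_inr, Equiv.symm_apply_apply,
          Equiv.apply_symm_apply] using H (finProdFinEquiv.symm i) (Sum.inr q)
  rw [this, Measure.pi_pi]
  simp only [Measure.pi_pi, Fintype.prod_sum_type, Sum.elim_inl, Sum.elim_inr]
  rw [Finset.prod_mul_distrib, Fintype.prod_prod_type (α₁ := Fin l),
    Fintype.prod_prod_type (α₁ := Fin (N * K)), Finset.prod_comm (s := (Finset.univ : Finset (Fin l)))]
  rw [← finProdFinEquiv.prod_comp, ← finProdFinEquiv.prod_comp]

lemma prob_blocks {Θ : Type*} [MeasurableSpace Θ] (μ : Measure Θ) [IsProbabilityMeasure μ]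
    (N : ℕ) (G : Fin N → Set Θ) (hG : ∀ j, MeasurableSet (G j)) (hpos : ∀ j, μ (G j) ≠ 0)
    (δ : ℝ) (hδ : 0 < δ) :
    ∃ K : ℕ, ENNReal.ofReal (1 - δ) ≤ Measure.pi (fun _ : Fin N × Fin K => μ)
      {z | ∀ j, ∃ k, z (j, k) ∈ G j} := by
  have hlim : Filter.Tendsto (fun K : ℕ => ∑ j, (μ (G j)ᶜ) ^ K) Filter.atTop (nhds 0) := by
    rw [show (0 : ENNReal) = ∑ j : Fin N, 0 by simp]
    refine tendsto_finsetSum _ fun j _ => ?_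
    refine ENNReal.tendsto_pow_atTop_nhds_zero_of_lt_one ?_
    rw [prob_compl_eq_one_sub (hG j)]
    exact ENNReal.sub_lt_self (by simp) (by simp) (hpos j)
  obtain ⟨K, hK⟩ := (hlim.eventually (gt_mem_nhds (ENNReal.ofReal_pos.2 hδ))).exists
  refine ⟨K, ?_⟩
  let Bad : Fin N → Set (Fin N × Fin K → Θ) := fun j =>
    Set.univ.pi (fun jk => if jk.1 = j then (G j)ᶜ else Set.univ)
  have hBm : ∀ j, MeasurableSet (Bad j) := fun j =>
    MeasurableSet.univ_pi fun jk => by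
      split_ifs
      · exact (hG j).compl
      · exact MeasurableSet.univ
  have hB : ∀ j, Measure.pi (fun _ : Fin N × Fin K => μ) (Bad j) = (μ (G j)ᶜ) ^ K := by
    intro j
    rw [Measure.pi_pi, Fintype.prod_prod_type, Finset.prod_eq_single j]
    · simp
    · intro i _ hi; simp [hi]
    · simp
  have hset : {z : Fin N × Fin K → Θ | ∀ j, ∃ k, z (j, k) ∈ G j} = (⋃ j, Bad j)ᶜ := by
    ext z
    simp only [Set.mem_ofPred_eq, Set.mem_compl_iff, Set.mem_iUnion, not_exists]
    refine forall_congr' fun j => ?_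
    simp only [Bad, Set.mem_univ_pi, not_forall]
    constructor
    · rintro ⟨k, hk⟩; exact ⟨(j, k), by simpa using hk⟩
    · rintro ⟨⟨i, k⟩, hk⟩
      by_cases hi : i = j
      · subst hi; exact ⟨k, by simpa using hk⟩
      · simp [hi] at hk
  rw [hset, prob_compl_eq_one_sub (MeasurableSet.iUnion hBm), ENNReal.ofReal_sub _ hδ.le,
    ENNReal.ofReal_one]
  refine tsub_le_tsub_left ?_ _
  refine (measure_iUnion_fintype_le _ _).trans ?_
  simp only [hB]
  exact hK.le

/-- Bias-learning universal approximation for feed-forward ReLU networks: for any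
continuous target `h` on a compact `U`, any `ε > 0`, `δ ∈ (0,1)`, and `R > 0`, there is a
hidden width `m` such that, with all entries of the weight matrices mutually independent
and uniform on `[-R, R]`, with probability at least `1 - δ` there exists a bias vector
`b` making the network `ε`-close to `h` in `L¹(U)`. -/
theorem bias_learning_ffn_universal
    (d l : ℕ) (hd : 1 ≤ d) (hl : 1 ≤ l)
    (U : Set (Fin d → ℝ)) (hU : IsCompact U)
    (h : (Fin d → ℝ) → Fin l → ℝ) (hh : Continuous h)
    (ε δ R : ℝ) (hε : 0 < ε) (hδ : δ ∈ Set.Ioo (0 : ℝ) 1) (hR : 0 < R) :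
    ∃ m : ℕ,
      ENNReal.ofReal (1 - δ) ≤
        Measure.pi (fun _ : WeightIdx m d l => unif R)
          {ω | ∃ b : Fin m → ℝ,
            (∫ x in U, ∑ p, |h x p -
              ∑ i, ω (Sum.inl (p, i)) *
                relu (∑ q, ω (Sum.inr (i, q)) * x q + b i)|) ≤ ε} := by
  have hCpt : CompactSpace U := isCompact_iff_compactSpace.1 hU
  have := unif_prob R hR
  have hvol : volume U < ⊤ := hU.measure_lt_top
  obtain ⟨V, hV⟩ : ∃ V, V = (volume : Measure (Fin d → ℝ)).real U := ⟨_, rfl⟩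
  have hV0 : 0 ≤ V := hV ▸ measureReal_nonneg
  obtain ⟨η, hηdef⟩ : ∃ η, η = ε / (2 * l * (V + 1)) := ⟨_, rfl⟩
  have hl' : (0:ℝ) < l := by exact_mod_cast hl
  have hη : 0 < η := by rw [hηdef]; positivity
  obtain ⟨N, a, w, c, ha, hw, happ⟩ := approx_vector d l U hU h hh R hR η hη
  obtain ⟨M, hM⟩ := hU.isBounded.exists_norm_le
  let F : Fin N → C(((Fin l ⊕ Fin d) → ℝ) × U, Fin l → ℝ) := fun j =>
    ⟨fun z p => z.1 (Sum.inl p) * relu (∑ q, z.1 (Sum.inr q) * z.2.1 q + c j), by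
      have hx : ∀ q, Continuous (fun z : ((Fin l ⊕ Fin d) → ℝ) × U => z.2.1 q) := fun q =>
        (continuous_apply q).comp (continuous_subtype_val.comp continuous_snd)
      have hz : ∀ s, Continuous (fun z : ((Fin l ⊕ Fin d) → ℝ) × U => z.1 s) := fun s =>
        (continuous_apply s).comp continuous_fst
      unfold relu
      exact continuous_pi fun p => (hz _).mul (((continuous_finsetSum _ fun q _ =>
        (hz _).mul (hx q)).add continuous_const).max continuous_const)⟩
  let θ : Fin N → (Fin l ⊕ Fin d) → ℝ := fun j => Sum.elim (a j) (w j)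
  let G : Fin N → Set ((Fin l ⊕ Fin d) → ℝ) := fun j =>
    (F j).curry ⁻¹' Metric.ball ((F j).curry (θ j)) (η / (N + 1))
  have hη' : 0 < η / (N + 1) := by positivity
  have hGo : ∀ j, IsOpen (G j) := fun j => Metric.isOpen_ball.preimage (F j).curry.continuous
  obtain ⟨K, hK⟩ := prob_blocks (Measure.pi (fun _ : Fin l ⊕ Fin d => unif R)) N G
    (fun j => (hGo j).measurableSet)
    (fun j => pi_unif_pos R hR (θ j) (by
      intro s
      rcases s with p | q
      · exact ha j p
      · exact hw j q) (G j) (hGo j) (Metric.mem_ball_self hη')) δ hδ.1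
  refine ⟨N * K, hK.trans ?_⟩
  rw [regroup_map N K d l R hR]
  refine le_trans (measure_mono ?_) (Measure.le_map_apply regroup_measurable.aemeasurable _)
  intro z hz
  choose k hk using hz
  let b' : Fin N × Fin K → ℝ := fun jk =>
    if jk.2 = k jk.1 then c jk.1 else -∑ q, |z jk (Sum.inr q)| * M
  refine ⟨fun i => b' (finProdFinEquiv.symm i), ?_⟩
  have hnet : ∀ x ∈ U, ∀ p, ∑ i, regroup z (Sum.inl (p, i)) *
      relu (∑ q, regroup z (Sum.inr (i, q)) * x q + b' (finProdFinEquiv.symm i)) =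
      ∑ j, z (j, k j) (Sum.inl p) * relu (∑ q, z (j, k j) (Sum.inr q) * x q + c j) := by
    intro x hx p
    rw [← finProdFinEquiv.sum_comp]
    simp only [regroup, Sum.elim_inl, Sum.elim_inr, Equiv.symm_apply_apply]
    rw [Fintype.sum_prod_type]
    refine Finset.sum_congr rfl fun j _ => ?_
    rw [Finset.sum_eq_single (k j)]
    · simp [b']
    · intro k' _ hk'
      have : relu (∑ q, z (j, k') (Sum.inr q) * x q + b' (j, k')) = 0 := by
        unfold relu
        refine max_eq_right ?_
        simp only [b', hk', if_false]
        have : ∑ q, z (j, k') (Sum.inr q) * x q ≤ ∑ q, |z (j, k') (Sum.inr q)| * M := by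
          refine Finset.sum_le_sum fun q _ => (le_abs_self _).trans ?_
          rw [abs_mul]
          exact mul_le_mul_of_nonneg_left ((norm_le_pi_norm x q).trans (hM x hx)) (abs_nonneg _)
        linarith
      rw [this, mul_zero]
    · simp
  have hpt : ∀ x ∈ U, ∀ p, |h x p - ∑ i, regroup z (Sum.inl (p, i)) *
      relu (∑ q, regroup z (Sum.inr (i, q)) * x q + b' (finProdFinEquiv.symm i))| ≤ 2 * η := by
    intro x hx p
    rw [hnet x hx p]
    have h1 := happ x hx p
    have h2 : |∑ j, z (j, k j) (Sum.inl p) * relu (∑ q, z (j, k j) (Sum.inr q) * x q + c j) -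
        ∑ j, a j p * relu (∑ q, w j q * x q + c j)| ≤ η := by
      rw [← Finset.sum_sub_distrib]
      calc _ ≤ ∑ j : Fin N, η / (N + 1) := by
            refine (Finset.abs_sum_le_sum_abs _ _).trans (Finset.sum_le_sum fun j _ => ?_)
            have h3 := (Metric.mem_ball.1 (Set.mem_preimage.1 (hk j))).le
            have h4 := (ContinuousMap.dist_apply_le_dist (⟨x, hx⟩ : U)).trans h3
            exact (dist_le_pi_dist _ _ p).trans h4
        _ = N * (η / (N + 1)) := by simp
        _ ≤ η := by
            rw [mul_div_assoc', div_le_iff₀ (by positivity)]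
            nlinarith
    rw [abs_le] at h1 h2 ⊢
    constructor <;> linarith [h1.1, h1.2, h2.1, h2.2]
  refine (Real.le_norm_self _).trans ((norm_setIntegral_le_of_norm_le_const (C := l * (2 * η))
    hvol ?_).trans ?_)
  · intro x hx
    rw [Real.norm_eq_abs, abs_of_nonneg (Finset.sum_nonneg fun _ _ => abs_nonneg _)]
    refine (Finset.sum_le_sum fun p _ => hpt x hx p).trans ?_
    simp
  · rw [← hV, hηdef]
    have : (l:ℝ) * (2 * (ε / (2 * l * (V + 1)))) * V = ε * (V / (V + 1)) := by
      field_simp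
    rw [this]
    exact mul_le_of_le_one_right hε.le ((div_le_one (by linarith)).2 (by linarith))
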